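/- For any multiplicative characters A, B, C, D of F_q and any x ∈ F_q, one has ₃F₂(A, B, C; A, D; x) = binom(B, A)·₂F₁(B, C; D; x) − Ā(−x)·binom(CĀ, DĀ) + (q−1)·A(−1)·D̄(x)·C̄D(1−x)·δ(B). -/

import Mathlib

open Finset

namespace FFAppell

variable {F : Type*} [Field F] [Fintype F] [DecidableEq F]

/-- The multiplicative characters of a finite field form a finite type. -/
noncomputable instance : Fintype (MulChar F ℂ) := Fintype.ofFinite _

/-- The Jacobi sum `J(χ, λ) = Σ_{u ∈ F} χ(u)·λ(1−u)`. -/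
noncomputable def J (χ lam : MulChar F ℂ) : ℂ := ∑ u : F, χ u * lam (1 - u)

/-- The binomial coefficient `binom(A, B) := B(−1)·J(A, B̄)`. -/
noncomputable def binom (A B : MulChar F ℂ) : ℂ := B (-1) * J A B⁻¹

/-- `δ(χ) = 1` if `χ` is the trivial character, `0` otherwise. -/
noncomputable def δchar (χ : MulChar F ℂ) : ℂ := if χ = 1 then 1 else 0

/-- `δ(x) = 1` if `x = 0`, `0` otherwise. -/
def δ (x : F) : ℂ := if x = 0 then 1 else 0

/-- The finite-field Gauss hypergeometric function
`₂F₁(A, B; C; x) := ε(x)·BC(−1)·Σ_{y ∈ F} B(y)·B̄C(1−y)·Ā(1−xy)`,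
where `ε = 1` is the trivial character (with `ε 0 = 0`). -/
noncomputable def twoF1 (A B C : MulChar F ℂ) (x : F) : ℂ :=
  (1 : MulChar F ℂ) x * (B * C) (-1) *
    ∑ y : F, B y * (B⁻¹ * C) (1 - y) * A⁻¹ (1 - x * y)

/-- The finite-field `₃F₂` function:
`₃F₂(A₀,A₁,A₂; B₁,B₂; x) := (1/(q−1))·Σ_χ binom(A₀χ,χ)·binom(A₁χ,B₁χ)·binom(A₂χ,B₂χ)·χ(x)`. -/
noncomputable def threeF2 (A₀ A₁ A₂ B₁ B₂ : MulChar F ℂ) (x : F) : ℂ :=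
  (1 / ((Fintype.card F : ℂ) - 1)) *
    ∑ χ : MulChar F ℂ, binom (A₀ * χ) χ * binom (A₁ * χ) (B₁ * χ) *
      binom (A₂ * χ) (B₂ * χ) * χ x

/-- The finite-field Appell function `F₁(A; B, B'; C; x, y)`:
`ε(xy)·BB'(−1)·Σ_{u,v ∈ F} B(u)·B'(v)·(C·B̄·B̄')(1−u−v)·Ā(1−ux−vy)`. -/
noncomputable def AppellF1 (A B B' C : MulChar F ℂ) (x y : F) : ℂ :=
  (1 : MulChar F ℂ) (x * y) * (B * B') (-1) *
    ∑ u : F, ∑ v : F,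
      B u * B' v * (C * B⁻¹ * B'⁻¹) (1 - u - v) * A⁻¹ (1 - u * x - v * y)

theorem char_neg_one_mul_self {K : Type*} [Field K] (χ : MulChar K ℂ) : χ (-1) * χ (-1) = 1 := by
  rw [← map_mul]; simp

theorem char_neg {K : Type*} [Field K] (χ : MulChar K ℂ) (a : K) : χ (-a) = χ (-1) * χ a := by
  rw [← map_mul, neg_one_mul]

theorem char_inv {K : Type*} [Field K] (χ : MulChar K ℂ) (a : K) : χ a⁻¹ = (χ a)⁻¹ := by
  rw [← MulChar.inv_apply', MulChar.inv_apply_eq_inv']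

theorem char_ne_zero {K : Type*} [Field K] (χ : MulChar K ℂ) {a : K} (ha : a ≠ 0) : χ a ≠ 0 :=
  MulChar.apply_ne_zero_iff.mpr ha.isUnit

theorem char_neg_one_inv {K : Type*} [Field K] (χ : MulChar K ℂ) : (χ (-1))⁻¹ = χ (-1) :=
  inv_eq_of_mul_eq_one_left (char_neg_one_mul_self χ)

theorem sum_char (χ : MulChar F ℂ) : ∑ u : F, χ u = ((Fintype.card F : ℂ) - 1) * δchar χ := by
  unfold δchar
  split_ifs with h
  · rw [h, MulChar.sum_one_eq_card_units, Fintype.card_units,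
      Nat.cast_sub Fintype.card_pos, Nat.cast_one, mul_one]
  · rw [MulChar.sum_eq_zero_of_ne_one h, mul_zero]

theorem card_sub_one_ne_zero {K : Type*} [Field K] [Fintype K] :
    (Fintype.card K : ℂ) - 1 ≠ 0 :=
  sub_ne_zero.mpr (Nat.cast_ne_one.mpr Fintype.one_lt_card.ne')

theorem sum_mulChar_apply (a : F) :
    ∑ χ : MulChar F ℂ, χ a = if a = 1 then (Fintype.card F : ℂ) - 1 else 0 := by
  split_ifs with ha
  · simp only [ha, map_one, Finset.sum_const, Finset.card_univ, nsmul_eq_mul, mul_one]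
    rw [← Nat.card_eq_fintype_card, MulChar.card_eq_card_units_of_hasEnoughRootsOfUnity,
      Nat.card_eq_fintype_card, Fintype.card_units, Nat.cast_sub Fintype.card_pos, Nat.cast_one]
  · obtain ⟨χ, hχ⟩ := MulChar.exists_apply_ne_one_of_hasEnoughRootsOfUnity F ℂ ha
    refine eq_zero_of_mul_eq_self_left hχ ?_
    simp only [Finset.mul_sum, ← MulChar.mul_apply]
    exact Fintype.sum_bijective _ (Group.mulLeft_bijective χ) _ _ fun χ' ↦ rfl

/-- Orthogonality of the multiplicative characters. -/
theorem sum_mulChar_inv_mul (a : F) {x : F} (hx : x ≠ 0) :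
    ∑ χ : MulChar F ℂ, χ⁻¹ a * χ x = if a = x then (Fintype.card F : ℂ) - 1 else 0 := by
  rcases eq_or_ne a 0 with rfl | ha
  · simp [hx.symm, MulChar.map_zero]
  · simp only [MulChar.inv_apply', ← map_mul, sum_mulChar_apply]
    simp only [inv_mul_eq_one₀ ha]

/-- The substitution `u ↦ u / (u - 1)` in a Jacobi sum. -/
theorem J_eq_neg_one_mul_J {K : Type*} [Field K] [Fintype K] (S T : MulChar K ℂ) :
    J S T = S (-1) * J S (S * T)⁻¹ := by
  unfold J
  rw [← Equiv.sum_comp (Equiv.subLeft (1 : K)), ← Equiv.sum_comp (Equiv.inv K),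
    ← Equiv.sum_comp (Equiv.subLeft (1 : K)), Finset.mul_sum]
  refine Finset.sum_congr rfl fun u _ ↦ ?_
  rcases eq_or_ne (1 - u) 0 with h | h
  · simp [h, MulChar.map_zero]
  · have h' : 1 - (1 - u)⁻¹ = -1 * u * (1 - u)⁻¹ := by field_simp; ring
    simp only [Equiv.subLeft_apply, Equiv.inv_apply, sub_sub_cancel]
    simp only [h', map_mul, mul_inv, MulChar.mul_apply, MulChar.inv_apply_eq_inv', char_inv]
    ring

theorem J_comm {K : Type*} [Field K] [Fintype K] (S T : MulChar K ℂ) : J S T = J T S := by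
  unfold J
  rw [← Equiv.sum_comp (Equiv.subLeft (1 : K))]
  exact Finset.sum_congr rfl fun u _ ↦ by simp [mul_comm]

theorem binom_eq_J {K : Type*} [Field K] [Fintype K] (A B : MulChar K ℂ) :
    binom A B = J B⁻¹ (B * A⁻¹) := by
  have h : (B⁻¹ * A)⁻¹ = B * A⁻¹ := by rw [mul_inv, inv_inv]
  rw [binom, J_comm, J_eq_neg_one_mul_J, h, MulChar.inv_apply_eq_inv', ← mul_assoc,
    mul_inv_cancel₀ (char_ne_zero B (neg_ne_zero.mpr one_ne_zero)), one_mul]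

theorem sum_mul_add {K : Type*} [Field K] [Fintype K] (P Q : MulChar K ℂ) {a b : K}
    (ha : a ≠ 0) (hb : b ≠ 0) :
    ∑ u : K, P u * Q (a + b * u) = P (-1) * P a * P⁻¹ b * Q a * J P Q := by
  unfold J
  rw [← Equiv.sum_comp (Equiv.mulLeft₀ (-1 * a * b⁻¹) (by simp [ha, hb])), Finset.mul_sum]
  refine Finset.sum_congr rfl fun u _ ↦ ?_
  have h : a + b * (-1 * a * b⁻¹ * u) = a * (1 - u) := by field_simp; ring
  simp only [Equiv.mulLeft₀_apply, h, map_mul, char_inv, MulChar.inv_apply_eq_inv']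
  ring

theorem inv_mul_J (R Q : MulChar F ℂ) (u : F) :
    R⁻¹ (1 - u) * J R Q = ∑ w : F, R w * Q (1 - w + w * u) -
      if u = 1 then ((Fintype.card F : ℂ) - 1) * δchar R else 0 := by
  rcases eq_or_ne u 1 with rfl | hu
  · simp [sum_char, MulChar.map_zero]
  · have h : u - 1 ≠ 0 := sub_ne_zero.mpr hu
    have e : ∀ w : F, 1 - w + w * u = 1 + (u - 1) * w := fun w ↦ by ring
    simp only [e, sum_mul_add R Q one_ne_zero h, if_neg hu]
    rw [← neg_sub u 1, char_neg]
    simp [MulChar.inv_apply_eq_inv', char_neg_one_inv]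

/-- The product of two Jacobi sums sharing a character and its inverse. -/
theorem J_mul_J (P Q R : MulChar F ℂ) :
    J P R⁻¹ * J R Q = P (-1) * J P Q * J (R * P⁻¹) (P * Q)
      + ((Fintype.card F : ℂ) - 1) * δchar (P * Q) - ((Fintype.card F : ℂ) - 1) * δchar R := by
  have inner (w : F) : R w * ∑ u : F, P u * Q (1 - w + w * u) =
      P (-1) * J P Q * ((R * P⁻¹) w * (P * Q) (1 - w)) +
        if w = 1 then ((Fintype.card F : ℂ) - 1) * δchar (P * Q) else 0 := by
    rcases eq_or_ne w 1 with rfl | hw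
    · simp [← sum_char, MulChar.map_zero]
    rcases eq_or_ne w 0 with rfl | hw0
    · simp [MulChar.map_zero]
    · rw [sum_mul_add P Q (sub_ne_zero.mpr hw.symm) hw0, if_neg hw]
      simp only [MulChar.mul_apply]
      ring
  have swap : ∑ u : F, P u * ∑ w : F, R w * Q (1 - w + w * u) =
      ∑ w : F, R w * ∑ u : F, P u * Q (1 - w + w * u) := by
    simp only [Finset.mul_sum]
    rw [Finset.sum_comm]
    exact Finset.sum_congr rfl fun w _ ↦ Finset.sum_congr rfl fun u _ ↦ by ring
  calc J P R⁻¹ * J R Q = ∑ u : F, P u * (R⁻¹ (1 - u) * J R Q) := by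
        conv_lhs => rw [J, Finset.sum_mul]
        exact Finset.sum_congr rfl fun u _ ↦ by ring
    _ = ∑ w : F, R w * ∑ u : F, P u * Q (1 - w + w * u)
          - ((Fintype.card F : ℂ) - 1) * δchar R := by
        simp only [inv_mul_J, mul_sub, Finset.sum_sub_distrib, swap]
        simp
    _ = _ := by
        simp only [inner, Finset.sum_add_distrib, ← Finset.mul_sum]
        simp [J]

/-- The product formula `binom(Aχ, χ) binom(Bχ, Aχ) = binom(B, A) binom(Bχ, χ)`, with its
correction terms at trivial characters. -/
theorem binom_mul_binom (A B χ : MulChar F ℂ) :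
    binom (A * χ) χ * binom (B * χ) (A * χ) = binom B A * binom (B * χ) χ
      - ((Fintype.card F : ℂ) - 1) * A (-1) * δchar (A * χ)
      + ((Fintype.card F : ℂ) - 1) * A (-1) * δchar B := by
  have hχ := char_neg_one_mul_self χ
  have e₁ : B * χ * χ⁻¹ = B := by simp
  have e₂ : (B * (A * χ * (B * χ)⁻¹))⁻¹ = A⁻¹ := by
    rw [mul_comm B, ← div_eq_mul_inv, mul_div_mul_right_eq_div, div_mul_cancel]
  have key := J_mul_J (B * χ) χ⁻¹ (A * χ)
  rw [J_comm (A * χ * (B * χ)⁻¹), e₁, J_eq_neg_one_mul_J B, e₂] at key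
  have hB := char_neg_one_mul_self B
  simp only [binom, MulChar.mul_apply] at key ⊢
  linear_combination A (-1) * key * (χ (-1) * χ (-1)) +
    A (-1) * χ (-1) * χ (-1) * χ (-1) * J (B * χ) χ⁻¹ * J B A⁻¹ * hB +
    (A (-1) * χ (-1) * J (B * χ) χ⁻¹ * J B A⁻¹ + ((Fintype.card F : ℂ) - 1) * A (-1) *
      (δchar B - δchar (A * χ))) * hχ

theorem sum_binom_mul_apply (C D : MulChar F ℂ) (x : F) :
    ∑ χ : MulChar F ℂ, binom (C * χ) (D * χ) * χ x =
      ((Fintype.card F : ℂ) - 1) * (D⁻¹ x * (C⁻¹ * D) (1 - x)) := by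
  rcases eq_or_ne x 0 with rfl | hx
  · simp [MulChar.map_zero]
  have h (χ : MulChar F ℂ) : binom (C * χ) (D * χ) * χ x =
      ∑ u : F, D⁻¹ u * (C⁻¹ * D) (1 - u) * (χ⁻¹ u * χ x) := by
    have e : D * χ * (C * χ)⁻¹ = C⁻¹ * D := by
      rw [mul_inv, mul_mul_mul_comm, mul_inv_cancel, mul_one, mul_comm]
    rw [binom_eq_J, e, J, Finset.sum_mul]
    refine Finset.sum_congr rfl fun u _ ↦ ?_
    rw [mul_inv, MulChar.mul_apply]
    ring
  simp only [h]
  rw [Finset.sum_comm]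
  simp only [← Finset.mul_sum, sum_mulChar_inv_mul _ hx]
  simp [mul_comm]

/-- The expansion of `₂F₁` as a sum over multiplicative characters. -/
theorem sum_binom_mul_binom_mul_apply (B C D : MulChar F ℂ) (x : F) :
    ∑ χ : MulChar F ℂ, binom (B * χ) χ * binom (C * χ) (D * χ) * χ x =
      ((Fintype.card F : ℂ) - 1) * twoF1 B C D x := by
  rcases eq_or_ne x 0 with rfl | hx
  · simp [twoF1, MulChar.map_zero]
  have h (χ : MulChar F ℂ) : binom (B * χ) χ * binom (C * χ) (D * χ) * χ x =
      ∑ t : F, B⁻¹ (1 - t) * (χ⁻¹ t * (binom (C * χ) (D * χ) * χ x)) := by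
    have e : χ * (B * χ)⁻¹ = B⁻¹ := by simp
    rw [binom_eq_J (B * χ), e, J, mul_assoc, Finset.sum_mul]
    exact Finset.sum_congr rfl fun u _ ↦ by ring
  have h' (t : F) (χ : MulChar F ℂ) : χ⁻¹ t * (binom (C * χ) (D * χ) * χ x) =
      binom (C * χ) (D * χ) * χ (t⁻¹ * x) := by
    rw [map_mul, MulChar.inv_apply']; ring
  simp only [h]
  rw [Finset.sum_comm]
  simp only [← Finset.mul_sum, h', sum_binom_mul_apply]
  rw [twoF1, Finset.mul_sum, Finset.mul_sum, ← Equiv.sum_comp (Equiv.mulLeft₀ x hx)]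
  refine Finset.sum_congr rfl fun y _ ↦ ?_
  rcases eq_or_ne y 0 with rfl | hy
  · simp [MulChar.map_zero]
  have e : (x * y)⁻¹ * x = y⁻¹ := by field_simp
  have e' : 1 - y⁻¹ = -1 * (1 - y) * y⁻¹ := by field_simp; ring
  have hC := char_ne_zero C hy
  have hD := char_ne_zero D hy
  simp only [Equiv.mulLeft₀_apply, e, e', MulChar.mul_apply, MulChar.inv_apply_eq_inv', map_mul,
    char_inv, char_neg_one_inv, MulChar.one_apply hx.isUnit]
  field_simp

/-- Reduction of `₃F₂(A, B, C; A, D; x)` to a `₂F₁`. -/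
theorem threeF2_reduction (A B C D : MulChar F ℂ) (x : F) :
    threeF2 A B C A D x =
      binom B A * twoF1 B C D x
      - A⁻¹ (-x) * binom (C * A⁻¹) (D * A⁻¹)
      + ((Fintype.card F : ℂ) - 1) * A (-1) * D⁻¹ x * (C⁻¹ * D) (1 - x) * δchar B := by
  have term (χ : MulChar F ℂ) :
      binom (A * χ) χ * binom (B * χ) (A * χ) * binom (C * χ) (D * χ) * χ x =
        binom B A * (binom (B * χ) χ * binom (C * χ) (D * χ) * χ x)
        - (if A⁻¹ = χ then ((Fintype.card F : ℂ) - 1) * A (-1) *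
            (binom (C * χ) (D * χ) * χ x) else 0)
        + ((Fintype.card F : ℂ) - 1) * A (-1) * δchar B * (binom (C * χ) (D * χ) * χ x) := by
    rw [binom_mul_binom]
    simp only [δchar, mul_eq_one_iff_inv_eq]
    split_ifs <;> ring
  have hq := card_sub_one_ne_zero (K := F)
  have hA : A⁻¹ (-x) = A (-1) * A⁻¹ x := by
    rw [char_neg, MulChar.inv_apply_eq_inv', char_neg_one_inv]
  simp only [threeF2, term, Finset.sum_add_distrib, Finset.sum_sub_distrib, ← Finset.mul_sum,
    Finset.sum_ite_eq, Finset.mem_univ, if_true, sum_binom_mul_binom_mul_apply,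
    sum_binom_mul_apply, hA]
  field_simp

end FFAppell
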